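/- Let Ẽ = VᵀAV, let H̃ be an invertible r×r real matrix, let P̄_C = I + V H̃⁻¹ Vᵀ, and set ρ = H̃⁻¹ Ẽ − I. Then every real eigenvalue μ of P̄_C A satisfies min{1 + λ_min(Λ), λ_min(Λ_⊥)} − ξ_C ≤ μ ≤ max{1 + λ_max(Λ), λ_max(Λ_⊥)} + ξ_C, where ξ_C = ‖ρ‖₂. -/

import Mathlib

open Matrix

/-- The Euclidean (2-)norm of a vector in `ℝ^k`. -/
noncomputable def euclNorm {k : ℕ} (x : Fin k → ℝ) : ℝ := Real.sqrt (∑ i, x i ^ 2)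

/-- The largest singular value of a real matrix:
`σ_max(M) = max_{‖x‖₂ = 1} ‖M x‖₂`.  For a square matrix this is the spectral
norm `‖M‖₂`. -/
noncomputable def sigmaMax {m k : ℕ} (M : Matrix (Fin m) (Fin k) ℝ) : ℝ :=
  sSup {c : ℝ | ∃ x : Fin k → ℝ, euclNorm x = 1 ∧ c = euclNorm (M.mulVec x)}

/-- The smallest singular value of a real matrix:
`σ_min(M) = min_{‖x‖₂ = 1} ‖M x‖₂`. -/
noncomputable def sigmaMin {m k : ℕ} (M : Matrix (Fin m) (Fin k) ℝ) : ℝ :=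
  sInf {c : ℝ | ∃ x : Fin k → ℝ, euclNorm x = 1 ∧ c = euclNorm (M.mulVec x)}

lemma euclNorm_sq {k : ℕ} (x : Fin k → ℝ) : euclNorm x ^ 2 = x ⬝ᵥ x := by
  rw [euclNorm, Real.sq_sqrt (Finset.sum_nonneg fun i _ => sq_nonneg _)]
  simp [dotProduct, sq]

lemma euclNorm_nonneg {k : ℕ} (x : Fin k → ℝ) : 0 ≤ euclNorm x := Real.sqrt_nonneg _

lemma abs_dotProduct_le_euclNorm {k : ℕ} (x y : Fin k → ℝ) :
    |x ⬝ᵥ y| ≤ euclNorm x * euclNorm y := by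
  apply abs_le_of_sq_le_sq _ (mul_nonneg (euclNorm_nonneg x) (euclNorm_nonneg y))
  rw [mul_pow, euclNorm, euclNorm, Real.sq_sqrt (Finset.sum_nonneg fun i _ => sq_nonneg _),
    Real.sq_sqrt (Finset.sum_nonneg fun i _ => sq_nonneg _)]
  exact Finset.sum_mul_sq_le_sq_mul_sq _ _ _

lemma euclNorm_mulVec_le_sigmaMax {m k : ℕ} (M : Matrix (Fin m) (Fin k) ℝ) {x : Fin k → ℝ}
    (hx : euclNorm x = 1) : euclNorm (M *ᵥ x) ≤ sigmaMax M := by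
  refine le_csSup ⟨Real.sqrt (∑ i, ∑ j, M i j ^ 2), ?_⟩ ⟨x, hx, rfl⟩
  rintro c ⟨y, hy, rfl⟩
  refine Real.sqrt_le_sqrt (Finset.sum_le_sum fun i _ => ?_)
  have hy' : ∑ j, y j ^ 2 = 1 := by simpa [euclNorm] using hy
  simpa [hy', mulVec, dotProduct] using
    Finset.sum_mul_sq_le_sq_mul_sq Finset.univ (fun j => M i j) y

lemma sigmaMax_nonneg {m k : ℕ} (M : Matrix (Fin m) (Fin k) ℝ) : 0 ≤ sigmaMax M := by
  apply Real.sSup_nonneg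
  rintro c ⟨x, -, rfl⟩
  exact euclNorm_nonneg _

lemma abs_dotProduct_mulVec_le {k : ℕ} (M : Matrix (Fin k) (Fin k) ℝ) (x : Fin k → ℝ) :
    |x ⬝ᵥ M *ᵥ x| ≤ sigmaMax M * (x ⬝ᵥ x) := by
  rcases (euclNorm_nonneg x).eq_or_lt with h | h
  · have hx : x = 0 := by
      rw [← dotProduct_self_eq_zero, ← euclNorm_sq, ← h]
      simp
    simp [hx]
  · set c := euclNorm x with hc
    have hu : euclNorm (c⁻¹ • x) = 1 := by
      rw [← sq_eq_sq₀ (euclNorm_nonneg _) zero_le_one, euclNorm_sq, smul_dotProduct,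
        dotProduct_smul, ← euclNorm_sq, ← hc]
      simp only [smul_eq_mul]
      field_simp
    have h1 := (abs_dotProduct_le_euclNorm (c⁻¹ • x) (M *ᵥ (c⁻¹ • x))).trans
      (mul_le_mul_of_nonneg_left (euclNorm_mulVec_le_sigmaMax M hu) (euclNorm_nonneg _))
    rw [hu, one_mul, mulVec_smul, smul_dotProduct, dotProduct_smul, smul_eq_mul, smul_eq_mul,
      abs_mul, abs_mul, abs_of_pos (inv_pos.2 h)] at h1
    rw [← euclNorm_sq, ← hc]
    calc |x ⬝ᵥ M *ᵥ x| = c⁻¹ * (c⁻¹ * |x ⬝ᵥ M *ᵥ x|) * c ^ 2 := by field_simp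
      _ ≤ sigmaMax M * c ^ 2 := by gcongr

/-- A real eigenvalue of `diag(d) + 1 + M` lies within `‖M‖₂` of the interval
`[1 + min d, 1 + max d]`. -/
lemma eigenvalue_one_add_diagonal_add_bounds {k : ℕ} (d : Fin k → ℝ)
    (M : Matrix (Fin k) (Fin k) ℝ) {x : Fin k → ℝ} (hx : x ≠ 0) {μ : ℝ}
    (h : (diagonal d + 1 + M) *ᵥ x = μ • x) :
    1 + (⨅ i, d i) - sigmaMax M ≤ μ ∧ μ ≤ 1 + (⨆ i, d i) + sigmaMax M := by
  have hpos : 0 < x ⬝ᵥ x :=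
    lt_of_le_of_ne (euclNorm_sq x ▸ sq_nonneg _) (Ne.symm (by simpa using hx))
  have hb := abs_le.1 (abs_dotProduct_mulVec_le M x)
  have heq : x ⬝ᵥ diagonal d *ᵥ x + x ⬝ᵥ x + x ⬝ᵥ M *ᵥ x = μ * (x ⬝ᵥ x) := by
    rw [← smul_eq_mul μ, ← dotProduct_smul, ← h, add_mulVec, add_mulVec, one_mulVec,
      dotProduct_add, dotProduct_add]
  have hd : x ⬝ᵥ diagonal d *ᵥ x = ∑ i, d i * (x i * x i) := by
    simp only [dotProduct, mulVec_diagonal]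
    exact Finset.sum_congr rfl fun i _ => by ring
  have hlo : (⨅ i, d i) * (x ⬝ᵥ x) ≤ x ⬝ᵥ diagonal d *ᵥ x := by
    rw [hd, dotProduct, Finset.mul_sum]
    exact Finset.sum_le_sum fun i _ =>
      mul_le_mul_of_nonneg_right (ciInf_le (Set.finite_range d).bddBelow i) (mul_self_nonneg _)
  have hhi : x ⬝ᵥ diagonal d *ᵥ x ≤ (⨆ i, d i) * (x ⬝ᵥ x) := by
    rw [hd, dotProduct, Finset.mul_sum]
    exact Finset.sum_le_sum fun i _ =>
      mul_le_mul_of_nonneg_right (le_ciSup (Set.finite_range d).bddAbove i) (mul_self_nonneg _)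
  constructor
  · refine le_of_mul_le_mul_right ?_ hpos
    linarith [hb.1]
  · refine le_of_mul_le_mul_right ?_ hpos
    linarith [hb.2]

/-- Same context as Statement 15, but with `P̄_C = I + V H̃⁻¹ Vᵀ` and
`ρ = H̃⁻¹ Ẽ − I`.  Then every real eigenvalue `μ` of `P̄_C A` satisfies
`min{1 + λ_min(Λ), λ_min(Λ_⊥)} − ξ_C ≤ μ ≤ max{1 + λ_max(Λ), λ_max(Λ_⊥)} + ξ_C`
with `ξ_C = ‖ρ‖₂`. -/
theorem stmt_16 (r s : ℕ) (hr : 0 < r) (hs : 0 < s)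
    (A : Matrix (Fin (r + s)) (Fin (r + s)) ℝ) (hA : A.PosDef)
    (lam : Fin (r + s) → ℝ) (U : Matrix (Fin (r + s)) (Fin (r + s)) ℝ)
    (hU : Uᵀ * U = 1) (hAU : A * U = U * Matrix.diagonal lam)
    (V : Matrix (Fin (r + s)) (Fin r) ℝ) (hV : V = U.submatrix id (Fin.castAdd s))
    (Et : Matrix (Fin r) (Fin r) ℝ) (hEt : Et = Vᵀ * A * V)
    (H : Matrix (Fin r) (Fin r) ℝ) (hH : IsUnit H.det)
    (P : Matrix (Fin (r + s)) (Fin (r + s)) ℝ) (hP : P = 1 + V * H⁻¹ * Vᵀ)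
    (ρ : Matrix (Fin r) (Fin r) ℝ) (hρ : ρ = H⁻¹ * Et - 1)
    (lamMax : ℝ) (hlamMax : lamMax = ⨆ i : Fin r, lam (Fin.castAdd s i))
    (lamMin : ℝ) (hlamMin : lamMin = ⨅ i : Fin r, lam (Fin.castAdd s i))
    (lamMaxPerp : ℝ) (hlamMaxPerp : lamMaxPerp = ⨆ i : Fin s, lam (Fin.natAdd r i))
    (lamMinPerp : ℝ) (hlamMinPerp : lamMinPerp = ⨅ i : Fin s, lam (Fin.natAdd r i))
    (ξC : ℝ) (hξC : ξC = sigmaMax ρ) :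
    ∀ μ ∈ spectrum ℝ (P * A),
      min (1 + lamMin) lamMinPerp - ξC ≤ μ ∧ μ ≤ max (1 + lamMax) lamMaxPerp + ξC := by
  intro μ hμ
  have hξ : 0 ≤ ξC := hξC ▸ sigmaMax_nonneg ρ
  obtain ⟨w, hw0, hw⟩ : ∃ w, w ≠ 0 ∧ (P * A) *ᵥ w = μ • w := by
    rw [← spectrum_toLin', ← Module.End.hasEigenvalue_iff_mem_spectrum] at hμ
    obtain ⟨w, hw⟩ := hμ.exists_hasEigenvector
    exact ⟨w, hw.2, by simpa using hw.apply_eq_smul⟩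
  have hAT : Aᵀ = A := by simpa [conjTranspose_eq_transpose_of_trivial] using hA.isHermitian.eq
  have hUA : Uᵀ * A = diagonal lam * Uᵀ := by
    simpa [transpose_mul, hAT] using congrArg transpose hAU
  have hVA : Vᵀ * A = diagonal (fun i => lam (Fin.castAdd s i)) * Vᵀ := by
    ext i j
    have := congrFun₂ hUA (Fin.castAdd s i) j
    rw [diagonal_mul] at this ⊢
    rw [hV]
    exact this
  have hVV : Vᵀ * V = 1 := by
    ext i j
    have := congrFun₂ hU (Fin.castAdd s i) (Fin.castAdd s j)
    rw [hV]
    refine Eq.trans this ?_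
    simp [one_apply]
  have hEt' : Et = diagonal (fun i => lam (Fin.castAdd s i)) := by
    rw [hEt, hVA, Matrix.mul_assoc, hVV, Matrix.mul_one]
  have hblock : Vᵀ * (P * A) = (diagonal (fun i => lam (Fin.castAdd s i)) + 1 + ρ) * Vᵀ := by
    have h1 : Vᵀ * P = (1 + H⁻¹) * Vᵀ := by
      rw [hP, Matrix.mul_add, Matrix.mul_one, ← Matrix.mul_assoc, ← Matrix.mul_assoc, hVV,
        Matrix.one_mul, Matrix.add_mul, Matrix.one_mul]
    rw [← Matrix.mul_assoc, h1, Matrix.mul_assoc, hVA, ← Matrix.mul_assoc, hρ, hEt']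
    congr 1
    rw [Matrix.add_mul, Matrix.one_mul]
    abel
  by_cases hy : Vᵀ *ᵥ w = 0
  · have hUw : Uᵀ *ᵥ w ≠ 0 := fun h => hw0 <| by
      rw [← one_mulVec w, ← mul_eq_one_comm.1 hU, ← mulVec_mulVec, h, mulVec_zero]
    obtain ⟨i, hi⟩ := Function.ne_iff.1 hUw
    have hPA : (P * A) *ᵥ w = A *ᵥ w := by
      have h2 : Vᵀ *ᵥ (A *ᵥ w) = 0 := by
        rw [mulVec_mulVec, hVA, ← mulVec_mulVec, hy, mulVec_zero]
      rw [hP, ← mulVec_mulVec, add_mulVec, one_mulVec, ← mulVec_mulVec, h2, mulVec_zero, add_zero]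
    have hlam : lam i = μ := by
      have h3 := congrArg (fun z => (Uᵀ *ᵥ z) i) (hPA.symm.trans hw)
      simp only [mulVec_mulVec, hUA, mulVec_smul] at h3
      rw [← mulVec_mulVec, mulVec_diagonal] at h3
      exact mul_right_cancel₀ hi h3
    induction i using Fin.addCases with
    | left i => exact absurd (by rw [hV] at hy; exact congrFun hy i) hi
    | right i =>
      have hlo : lamMinPerp ≤ μ := by
        rw [hlamMinPerp, ← hlam]
        exact ciInf_le (Set.finite_range fun i => lam (Fin.natAdd r i)).bddBelow i
      have hhi : μ ≤ lamMaxPerp := by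
        rw [hlamMaxPerp, ← hlam]
        exact le_ciSup (Set.finite_range fun i => lam (Fin.natAdd r i)).bddAbove i
      constructor
      · linarith [min_le_right (1 + lamMin) lamMinPerp]
      · linarith [le_max_right (1 + lamMax) lamMaxPerp]
  · have heig : (diagonal (fun i => lam (Fin.castAdd s i)) + 1 + ρ) *ᵥ (Vᵀ *ᵥ w)
        = μ • (Vᵀ *ᵥ w) := by
      rw [mulVec_mulVec, ← hblock, ← mulVec_mulVec, hw, mulVec_smul]
    obtain ⟨hlo, hhi⟩ := eigenvalue_one_add_diagonal_add_bounds _ ρ hy heig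
    rw [← hlamMin, ← hξC] at hlo
    rw [← hlamMax, ← hξC] at hhi
    constructor
    · linarith [min_le_left (1 + lamMin) lamMinPerp]
    · linarith [le_max_left (1 + lamMax) lamMaxPerp]
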